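/- arXiv:1304.0724 — 4 statements merged into one kernel-verified Lean document; each statement's English description precedes it below -/
import Mathlib

section
/- Let A be a Boolean algebra, let α and β be sets with α nonempty, and let ι : α → β be an injective map. Consider the pointwise Boolean algebras F₁ of all functions (α → α) → A and F₂ of all functions (β → α) → A. Define K : F₁ → F₂ by K(f)(x) = f(x ∘ ι). Then K is an injective Boolean homomorphism; moreover, for every τ : α → α and every τ̄ : β → β with τ̄ ∘ ι = ι ∘ τ, one has K(s_τ(f)) = s_{τ̄}(K(f)), where s_τ(f)(x) = f(x ∘ τ) on F₁ and s_{τ̄}(g)(x) = g(x ∘ τ̄) on F₂. -/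
/-- For a Boolean algebra `A`, types `α` (nonempty) and `β`, and an
injection `ι : α → β`, the map `K : ((α → α) → A) → ((β → α) → A)` given by
`K f x = f (x ∘ ι)` is an injective Boolean homomorphism between the pointwise
Boolean algebras, and it intertwines the substitution operators: whenever
`τ̄ ∘ ι = ι ∘ τ` one has `K (s_τ f) = s_τ̄ (K f)`. -/
theorem stmt_1 {A : Type*} [BooleanAlgebra A] {α β : Type*} [Nonempty α]
    (ι : α → β) (hι : Function.Injective ι)
    (K : ((α → α) → A) → ((β → α) → A))
    (hK : ∀ (f : (α → α) → A) (x : β → α), K f x = f (x ∘ ι)) :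
    Function.Injective K ∧
    K ⊥ = ⊥ ∧ K ⊤ = ⊤ ∧
    (∀ f g, K (f ⊓ g) = K f ⊓ K g) ∧
    (∀ f g, K (f ⊔ g) = K f ⊔ K g) ∧
    (∀ f, K fᶜ = (K f)ᶜ) ∧
    (∀ (τ : α → α) (τbar : β → β), τbar ∘ ι = ι ∘ τ →
      ∀ f : (α → α) → A,
        K (fun x => f (x ∘ τ)) = fun x => K f (x ∘ τbar)) := by
  refine ⟨fun f g hfg => ?_, ?_, ?_, fun f g => ?_, fun f g => ?_, fun f => ?_,
    fun τ τbar h f => ?_⟩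
  · funext y
    obtain ⟨x, rfl⟩ := hι.surjective_comp_right y
    simpa only [hK] using congrFun hfg x
  · funext x; simp [hK]
  · funext x; simp [hK]
  · funext x; simp [hK]
  · funext x; simp [hK]
  · funext x; simp [hK]
  · funext x
    simp only [hK, Function.comp_assoc, h]
end

section
/- Let B be a Boolean algebra, S a transformation system on B with index set β, and let α ⊆ β be an infinite subset. Then the set D = {S(σ)(a) : a ∈ Nr_α(B), σ : β → β with σ restricted to α injective} contains ⊥ and ⊤, contains Nr_α(B), and is closed under ⊓, ⊔ and complement; i.e., D is a Boolean subalgebra of B containing Nr_α(B). -/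
/-- An element `p` is supported by `J` (w.r.t. a transformation system `S` on
index set `I`) if `S σ₁ p = S σ₂ p` whenever `σ₁` and `σ₂` agree on `J`. -/
def SupportedBy {A : Type*} {I : Type*} (S : (I → I) → A → A)
    (J : Set I) (p : A) : Prop :=
  ∀ σ₁ σ₂ : I → I, (∀ j ∈ J, σ₁ j = σ₂ j) → S σ₁ p = S σ₂ p

/-- `Nr_J(A)`: the set of elements supported by `J`. -/
def NrSet {A : Type*} {I : Type*} (S : (I → I) → A → A) (J : Set I) : Set A :=
  {p | SupportedBy S J p}

/-- The images of an infinite set under two maps, the first of them injective on it, are jointly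
covered by a single injective reparametrization `ρ` of the set, with inverse `π` on the images. -/
theorem exists_injOn_common_reparametrization {β : Type*} {α : Set β} (hα : α.Infinite)
    {σ τ : β → β} (hσ : Set.InjOn σ α) :
    ∃ ρ π : β → β, Set.InjOn ρ α ∧
      ∀ u ∈ σ '' α ∪ τ '' α, π u ∈ α ∧ ρ (π u) = u := by
  classical
  have hcard : Cardinal.mk α = Cardinal.mk ↥(σ '' α ∪ τ '' α) := by
    apply le_antisymm
    · rw [← Cardinal.mk_image_eq_of_injOn σ α hσ]
      exact Cardinal.mk_le_mk_of_subset Set.subset_union_left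
    · have : Infinite α := hα.to_subtype
      calc Cardinal.mk ↥(σ '' α ∪ τ '' α)
          ≤ Cardinal.mk ↥(σ '' α) + Cardinal.mk ↥(τ '' α) := Cardinal.mk_union_le _ _
        _ ≤ Cardinal.mk α + Cardinal.mk α :=
          add_le_add Cardinal.mk_image_le Cardinal.mk_image_le
        _ = Cardinal.mk α := Cardinal.add_eq_self (Cardinal.aleph0_le_mk α)
  obtain ⟨e⟩ := Cardinal.eq.1 hcard
  refine ⟨fun x => if h : x ∈ α then e ⟨x, h⟩ else x,
    fun u => if h : u ∈ σ '' α ∪ τ '' α then e.symm ⟨u, h⟩ else u, ?_, ?_⟩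
  · intro x hx y hy hxy
    simp only [hx, hy, dif_pos] at hxy
    exact congrArg Subtype.val (e.injective (Subtype.ext hxy))
  · intro u hu
    simp only [dif_pos hu]
    refine ⟨(e.symm ⟨u, hu⟩).2, ?_⟩
    rw [dif_pos (e.symm ⟨u, hu⟩).2]
    simp

theorem SupportedBy.map {A I : Type*} {S : (I → I) → A → A}
    (hcomp : ∀ σ τ : I → I, S (σ ∘ τ) = S σ ∘ S τ) {J K : Set I} {p : A}
    (hp : SupportedBy S J p) {σ : I → I} (hσ : Set.MapsTo σ J K) :
    SupportedBy S K (S σ p) := by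
  intro f g hfg
  have h := hp (f ∘ σ) (g ∘ σ) fun j hj => hfg _ (hσ hj)
  simpa only [hcomp, Function.comp_apply] using h

/-- A supported element transformed by `σ` can be rewritten through any map `ρ` having a section
`π` on the image of the support under `σ`. -/
theorem SupportedBy.map_eq_map_map {A I : Type*} {S : (I → I) → A → A}
    (hcomp : ∀ σ τ : I → I, S (σ ∘ τ) = S σ ∘ S τ) {J : Set I} {p : A}
    (hp : SupportedBy S J p) {σ ρ π : I → I} (h : ∀ j ∈ J, ρ (π (σ j)) = σ j) :
    S σ p = S ρ (S (π ∘ σ) p) := by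
  rw [← Function.comp_apply (f := S ρ), ← hcomp]
  exact hp _ _ fun j hj => (h j hj).symm

/-- For a transformation system `S` on a Boolean algebra `B` with
index set `β` and an infinite subset `α ⊆ β`, the set
`D = {S σ a : a ∈ Nr_α(B), σ injective on α}` contains `⊥`, `⊤` and `Nr_α(B)`,
and is closed under `⊓`, `⊔` and complement. -/
theorem stmt_5 {B : Type*} [BooleanAlgebra B] {β : Type*}
    (S : (β → β) → B → B)
    (hbot : ∀ σ, S σ ⊥ = ⊥)
    (htop : ∀ σ, S σ ⊤ = ⊤)
    (hinf : ∀ σ p q, S σ (p ⊓ q) = S σ p ⊓ S σ q)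
    (hsup : ∀ σ p q, S σ (p ⊔ q) = S σ p ⊔ S σ q)
    (hcompl : ∀ σ p, S σ pᶜ = (S σ p)ᶜ)
    (hid : S id = id)
    (hcomp : ∀ σ τ : β → β, S (σ ∘ τ) = S σ ∘ S τ)
    (α : Set β) (hα : α.Infinite)
    (D : Set B)
    (hD : D = {b | ∃ (a : B) (σ : β → β),
      a ∈ NrSet S α ∧ Set.InjOn σ α ∧ b = S σ a}) :
    ⊥ ∈ D ∧ ⊤ ∈ D ∧ NrSet S α ⊆ D ∧
    (∀ p q, p ∈ D → q ∈ D → p ⊓ q ∈ D) ∧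
    (∀ p q, p ∈ D → q ∈ D → p ⊔ q ∈ D) ∧
    (∀ p, p ∈ D → pᶜ ∈ D) := by
  subst hD
  have common : ∀ p q, (∃ (a : B) (σ : β → β), a ∈ NrSet S α ∧ Set.InjOn σ α ∧ p = S σ a) →
      (∃ (a : B) (σ : β → β), a ∈ NrSet S α ∧ Set.InjOn σ α ∧ q = S σ a) →
      ∃ (a b : B) (ρ : β → β), a ∈ NrSet S α ∧ b ∈ NrSet S α ∧ Set.InjOn ρ α ∧
        p = S ρ a ∧ q = S ρ b := by
    rintro _ _ ⟨a, σ, ha, hσ, rfl⟩ ⟨b, τ, hb, -, rfl⟩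
    obtain ⟨ρ, π, hρ, hπ⟩ := exists_injOn_common_reparametrization hα (τ := τ) hσ
    have hl : ∀ j ∈ α, π (σ j) ∈ α ∧ ρ (π (σ j)) = σ j :=
      fun j hj => hπ _ (Or.inl ⟨j, hj, rfl⟩)
    have hr : ∀ j ∈ α, π (τ j) ∈ α ∧ ρ (π (τ j)) = τ j :=
      fun j hj => hπ _ (Or.inr ⟨j, hj, rfl⟩)
    exact ⟨S (π ∘ σ) a, S (π ∘ τ) b, ρ,
      SupportedBy.map hcomp ha fun j hj => (hl j hj).1,
      SupportedBy.map hcomp hb fun j hj => (hr j hj).1, hρ,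
      SupportedBy.map_eq_map_map hcomp ha fun j hj => (hl j hj).2,
      SupportedBy.map_eq_map_map hcomp hb fun j hj => (hr j hj).2⟩
  refine ⟨⟨⊥, id, fun f g _ => ?_, Set.injOn_id α, (hbot id).symm⟩,
    ⟨⊤, id, fun f g _ => ?_, Set.injOn_id α, (htop id).symm⟩,
    fun a ha => ⟨a, id, ha, Set.injOn_id α, by rw [hid, id]⟩, ?_, ?_, ?_⟩
  · rw [hbot, hbot]
  · rw [htop, htop]
  · intro p q hp hq
    obtain ⟨a, b, ρ, ha, hb, hρ, rfl, rfl⟩ := common p q hp hq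
    exact ⟨a ⊓ b, ρ, fun f g h => by rw [hinf, hinf, ha f g h, hb f g h], hρ, (hinf ρ a b).symm⟩
  · intro p q hp hq
    obtain ⟨a, b, ρ, ha, hb, hρ, rfl, rfl⟩ := common p q hp hq
    exact ⟨a ⊔ b, ρ, fun f g h => by rw [hsup, hsup, ha f g h, hb f g h], hρ, (hsup ρ a b).symm⟩
  · rintro _ ⟨a, σ, ha, hσ, rfl⟩
    exact ⟨aᶜ, σ, fun f g h => by rw [hcompl, hcompl, ha f g h], hσ, (hcompl σ a).symm⟩
end

section
/- Let A be a Boolean algebra and c : A → A a map satisfying c(⊥) = ⊥, x ≤ c(x) for all x ∈ A, and c(x ⊓ c(y)) = c(x) ⊓ c(y) for all x, y ∈ A. Then c is additive: c(x ⊔ y) = c(x) ⊔ c(y) for all x, y ∈ A. -/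
/-- A cylindrification `c` on a Boolean algebra (normal,
increasing, satisfying `c (x ⊓ c y) = c x ⊓ c y`) is additive. -/
theorem stmt_10 {A : Type*} [BooleanAlgebra A] (c : A → A)
    (hbot : c ⊥ = ⊥)
    (hle : ∀ x, x ≤ c x)
    (hcyl : ∀ x y, c (x ⊓ c y) = c x ⊓ c y) :
    ∀ x y : A, c (x ⊔ y) = c x ⊔ c y := by
  have mono : ∀ x y, x ≤ y → c x ≤ c y := by
    intro x y h
    have key := hcyl x y
    rw [inf_eq_left.2 (h.trans (hle y))] at key
    exact inf_eq_left.1 key.symm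
  have compl_closed : ∀ x, c (c x)ᶜ = (c x)ᶜ := by
    intro x
    refine le_antisymm ?_ (hle _)
    rw [le_compl_iff_disjoint_right, disjoint_iff, ← hcyl, compl_inf_eq_bot, hbot]
  intro x y
  refine le_antisymm ?_ (sup_le (mono _ _ le_sup_left) (mono _ _ le_sup_right))
  have inf_closed : c ((c x)ᶜ ⊓ (c y)ᶜ) = (c x)ᶜ ⊓ (c y)ᶜ := by
    have key := hcyl (c x)ᶜ (c y)ᶜ
    rwa [compl_closed, compl_closed] at key
  have sup_closed : c (c x ⊔ c y) = c x ⊔ c y := by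
    have key := compl_closed ((c x)ᶜ ⊓ (c y)ᶜ)
    rwa [inf_closed, compl_inf, compl_compl, compl_compl] at key
  exact (mono _ _ (sup_le_sup (hle x) (hle y))).trans_eq sup_closed
end

section
/- Let A be a Boolean algebra equipped with a normal additive operator c. Let Uf(A) be the set of ultrafilters of A, define the binary relation R on Uf(A) by R(t, u) iff c(x) ∈ u for every x ∈ t, and define r : A → 𝒫(Uf(A)) by r(a) = {u ∈ Uf(A) : a ∈ u}. Then r is an injective Boolean homomorphism into the powerset Boolean algebra of Uf(A), and for every a ∈ A, r(c(a)) = {u ∈ Uf(A) : there exists t ∈ Uf(A) with a ∈ t and R(t, u)}; i.e., r(c(a)) equals the complex-algebra operator of the frame (Uf(A), R) applied to r(a). -/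
/-- An ultrafilter of a Boolean algebra, as a set. -/
def IsUltra {A : Type*} [BooleanAlgebra A] (u : Set A) : Prop :=
  ⊤ ∈ u ∧ ⊥ ∉ u ∧
  (∀ a b : A, a ∈ u → a ≤ b → b ∈ u) ∧
  (∀ a b : A, a ∈ u → b ∈ u → a ⊓ b ∈ u) ∧
  (∀ a : A, a ∈ u ∨ aᶜ ∈ u)

namespace IsUltra

variable {A : Type*} [BooleanAlgebra A] {u : Set A}

theorem compl_mem_iff (hu : IsUltra u) {a : A} : aᶜ ∈ u ↔ a ∉ u := by
  obtain ⟨_, hbot, _, hinf, hcompl⟩ := hu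
  refine ⟨fun h ha ↦ hbot ?_, fun h ↦ (hcompl a).resolve_left h⟩
  simpa using hinf _ _ ha h

theorem inf_mem_iff (hu : IsUltra u) {a b : A} : a ⊓ b ∈ u ↔ a ∈ u ∧ b ∈ u := by
  obtain ⟨_, _, hup, hinf, _⟩ := hu
  exact ⟨fun h ↦ ⟨hup _ _ h inf_le_left, hup _ _ h inf_le_right⟩, fun h ↦ hinf _ _ h.1 h.2⟩

theorem sup_mem_iff (hu : IsUltra u) {a b : A} : a ⊔ b ∈ u ↔ a ∈ u ∨ b ∈ u := by
  rw [← not_iff_not, ← hu.compl_mem_iff, compl_sup, hu.inf_mem_iff, hu.compl_mem_iff,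
    hu.compl_mem_iff, not_or]

/-- The complement of a prime ideal is an ultrafilter. -/
theorem compl_of_isPrime {J : Order.Ideal A} (hJ : J.IsPrime) : IsUltra (J : Set A)ᶜ := by
  refine ⟨hJ.top_notMem, fun h ↦ h J.bot_mem, fun a b ha hab hb ↦ ha (J.lower hab hb),
    fun a b ha hb hab ↦ (hJ.mem_or_mem hab).elim ha hb, fun a ↦ ?_⟩
  by_contra! h
  simp only [Set.mem_compl_iff, not_not, SetLike.mem_coe] at h
  exact hJ.top_notMem (by simpa using Order.Ideal.sup_mem h.1 h.2)

/-- An element outside an ideal lies in an ultrafilter disjoint from that ideal. -/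
theorem exists_mem_disjoint {I : Order.Ideal A} {a : A} (ha : a ∉ I) :
    ∃ t : Set A, IsUltra t ∧ a ∈ t ∧ ∀ x ∈ t, x ∉ I := by
  have hdisj : Disjoint (Order.PFilter.principal a : Set A) (I : Set A) :=
    Set.disjoint_left.2 fun x hx hxI ↦ ha (I.lower (Order.PFilter.mem_principal.1 hx) hxI)
  obtain ⟨J, hJ, hIJ, hFJ⟩ := DistribLattice.prime_ideal_of_disjoint_filter_ideal hdisj
  exact ⟨_, compl_of_isPrime hJ,
    Set.disjoint_left.1 hFJ (Order.PFilter.mem_principal.2 le_rfl), fun x hx hxI ↦ hx (hIJ hxI)⟩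

theorem le_of_forall_mem {a b : A} (h : ∀ t : Set A, IsUltra t → a ∈ t → b ∈ t) : a ≤ b := by
  by_contra hab
  obtain ⟨t, ht, hat, hdisj⟩ :=
    exists_mem_disjoint (I := Order.Ideal.principal b) (mt Order.Ideal.mem_principal.1 hab)
  exact hdisj b (h t ht hat) (Order.Ideal.mem_principal.2 le_rfl)

/-- If `c a` lies in an ultrafilter `u`, then `a` lies in a predecessor of `u` in the canonical
frame. -/
theorem exists_predecessor (hu : IsUltra u) {c : A → A} (hcbot : c ⊥ = ⊥)
    (hcadd : ∀ x y, c (x ⊔ y) = c x ⊔ c y) {a : A} (ha : c a ∈ u) :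
    ∃ t : Set A, IsUltra t ∧ a ∈ t ∧ ∀ x ∈ t, c x ∈ u := by
  have hideal : Order.IsIdeal {x | c x ∉ u} := by
    refine ⟨fun x y hyx hx hy ↦ hx ?_, ⟨⊥, ?_⟩, fun x hx y hy ↦
      ⟨x ⊔ y, fun h ↦ ?_, le_sup_left, le_sup_right⟩⟩
    · rw [← sup_eq_left.2 hyx, hcadd]
      exact hu.sup_mem_iff.2 (Or.inr hy)
    · simpa only [Set.mem_ofPred_eq, hcbot] using hu.2.1
    · rw [hcadd] at h
      exact (hu.sup_mem_iff.1 h).elim hx hy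
  obtain ⟨t, ht, hat, hdisj⟩ := exists_mem_disjoint (I := hideal.toIdeal) (fun h ↦ h ha)
  exact ⟨t, ht, hat, fun x hx ↦ not_not.1 (hdisj x hx)⟩

end IsUltra

/-- For a Boolean algebra `A` with a normal additive operator
`c`, the representation map `r a = {u ∈ Uf(A) : a ∈ u}` is an injective
Boolean homomorphism into the powerset algebra of the set of ultrafilters, and
`r (c a)` equals the complex-algebra operator of the canonical frame
`(Uf(A), R)` applied to `r a`, where `R t u ↔ ∀ x ∈ t, c x ∈ u`. -/
theorem stmt_12 {A : Type*} [BooleanAlgebra A] (c : A → A)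
    (hcbot : c ⊥ = ⊥) (hcadd : ∀ x y, c (x ⊔ y) = c x ⊔ c y)
    (R : {u : Set A // IsUltra u} → {u : Set A // IsUltra u} → Prop)
    (hR : ∀ t u, R t u ↔ ∀ x ∈ t.1, c x ∈ u.1)
    (r : A → Set {u : Set A // IsUltra u})
    (hr : ∀ a, r a = {u | a ∈ u.1}) :
    Function.Injective r ∧
    r ⊥ = ⊥ ∧ r ⊤ = ⊤ ∧
    (∀ a b, r (a ⊓ b) = r a ⊓ r b) ∧
    (∀ a b, r (a ⊔ b) = r a ⊔ r b) ∧
    (∀ a, r aᶜ = (r a)ᶜ) ∧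
    (∀ a, r (c a) = {u | ∃ t, t ∈ r a ∧ R t u}) := by
  have mem_r {a : A} {u : {u : Set A // IsUltra u}} : u ∈ r a ↔ a ∈ u.1 := by
    rw [hr, Set.mem_ofPred_eq]
  refine ⟨fun a b hab ↦ ?_, ?_, ?_, fun a b ↦ ?_, fun a b ↦ ?_, fun a ↦ ?_, fun a ↦ ?_⟩
  · have hmem (t : Set A) (ht : IsUltra t) : a ∈ t ↔ b ∈ t := by
      simpa only [mem_r] using Set.ext_iff.1 hab ⟨t, ht⟩
    exact le_antisymm (IsUltra.le_of_forall_mem fun t ht ↦ (hmem t ht).1)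
      (IsUltra.le_of_forall_mem fun t ht ↦ (hmem t ht).2)
  · exact Set.eq_empty_of_forall_notMem fun u hu ↦ u.2.2.1 (mem_r.1 hu)
  · exact Set.eq_univ_of_forall fun u ↦ mem_r.2 u.2.1
  · ext u
    simpa only [Set.inf_eq_inter, Set.mem_inter_iff, mem_r] using u.2.inf_mem_iff
  · ext u
    simpa only [Set.sup_eq_union, Set.mem_union, mem_r] using u.2.sup_mem_iff
  · ext u
    simpa only [Set.mem_compl_iff, mem_r] using u.2.compl_mem_iff
  · ext u
    simp only [mem_r, Set.mem_ofPred_eq, hR]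
    constructor
    · intro ha
      obtain ⟨t, ht, hat, htu⟩ := u.2.exists_predecessor hcbot hcadd ha
      exact ⟨⟨t, ht⟩, hat, htu⟩
    · rintro ⟨t, hat, htu⟩
      exact htu a hat
end
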